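/- arXiv:1503.08366 — 3 statements merged into one kernel-verified Lean document; each statement's English description precedes it below -/
import Mathlib

section
/- Let A ∈ ℝ^{m×n} and ρ > 0. Suppose x^{k+1} ∈ ℝ^n satisfies (I + AᵀA)x^{k+1} = x^{k+1/2} + Aᵀy^{k+1/2} and y^{k+1} = A x^{k+1} (the graph projection step), and the scaled dual variables are updated by x̃^{k+1} = x̃^k + x^{k+1/2} − x^{k+1} and ỹ^{k+1} = ỹ^k + y^{k+1/2} − y^{k+1}. Define μ^k = −ρ x̃^k and ν^k = −ρ ỹ^k (and similarly at k+1). Then μ^{k+1} + Aᵀν^{k+1} = μ^k + Aᵀν^k. In particular, if (μ^0, ν^0) is dual feasible (μ^0 = −Aᵀν^0) then (μ^{k+1}, ν^{k+1}) is dual feasible for all k. -/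
open Matrix

/-- In graph projection splitting, with `μᵏ = −ρx̃ᵏ`, `νᵏ = −ρỹᵏ`, the quantity
`μᵏ + Aᵀνᵏ` is conserved: `μᵏ⁺¹ + Aᵀνᵏ⁺¹ = μᵏ + Aᵀνᵏ`. In particular, if `(μ⁰, ν⁰)`
is dual feasible (`μ⁰ = −Aᵀν⁰`), then `(μᵏ⁺¹, νᵏ⁺¹)` is dual feasible for all `k`. -/
theorem stmt_9 (m n : ℕ) (A : Matrix (Fin m) (Fin n) ℝ) (ρ : ℝ) (hρ : 0 < ρ)
    (xhalf : ℕ → Fin n → ℝ) (yhalf : ℕ → Fin m → ℝ)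
    (x : ℕ → Fin n → ℝ) (y : ℕ → Fin m → ℝ)
    (xt : ℕ → Fin n → ℝ) (yt : ℕ → Fin m → ℝ)
    (hproj : ∀ k, (1 + Aᵀ * A) *ᵥ x (k + 1) = xhalf k + Aᵀ *ᵥ yhalf k)
    (hyx : ∀ k, y (k + 1) = A *ᵥ x (k + 1))
    (hxt : ∀ k, xt (k + 1) = xt k + xhalf k - x (k + 1))
    (hyt : ∀ k, yt (k + 1) = yt k + yhalf k - y (k + 1)) :
    (∀ k, (-ρ) • xt (k + 1) + Aᵀ *ᵥ ((-ρ) • yt (k + 1)) =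
        (-ρ) • xt k + Aᵀ *ᵥ ((-ρ) • yt k)) ∧
      ((-ρ) • xt 0 = -(Aᵀ *ᵥ ((-ρ) • yt 0)) →
        ∀ k, (-ρ) • xt (k + 1) = -(Aᵀ *ᵥ ((-ρ) • yt (k + 1)))) := by
  have hcons : ∀ k, (-ρ) • xt (k + 1) + Aᵀ *ᵥ ((-ρ) • yt (k + 1)) =
      (-ρ) • xt k + Aᵀ *ᵥ ((-ρ) • yt k) := by
    intro k
    have h := hproj k
    rw [add_mulVec, one_mulVec, ← mulVec_mulVec] at h
    rw [mulVec_smul, mulVec_smul, ← smul_add, ← smul_add, hxt, hyt, hyx, mulVec_sub, mulVec_add]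
    congr 1
    linear_combination -h
  refine ⟨hcons, fun h0 k => ?_⟩
  have hzero : ∀ j, (-ρ) • xt j + Aᵀ *ᵥ ((-ρ) • yt j) = 0 := by
    intro j
    induction j with
    | zero => exact eq_neg_iff_add_eq_zero.mp h0
    | succ j ih => rw [hcons, ih]
  exact eq_neg_iff_add_eq_zero.mpr (hzero (k + 1))
end

section
/- Let A ∈ ℝ^{m×n} (m, n ≥ 1), p ≥ 1, and γ > 0. The regularized equilibration objective F(u, v) = Σ_{i=1}^m Σ_{j=1}^n |A_{ij}|^p e^{u_i + v_j} − n Σ_{i=1}^m u_i − m Σ_{j=1}^n v_j + γ[(1/m) Σ_{i=1}^m e^{u_i} + (1/n) Σ_{j=1}^n e^{v_j}] is bounded below on ℝ^m × ℝ^n. -/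
open Matrix

/-- The minimum value over `x` of `a * exp x - b * x`, as a lower bound. -/
theorem le_mul_exp_sub_mul {a b : ℝ} (ha : 0 < a) (hb : 0 < b) (x : ℝ) :
    b - b * Real.log (b / a) ≤ a * Real.exp x - b * x := by
  have hexp : a * Real.exp x = b * Real.exp (x - Real.log (b / a)) := by
    rw [Real.exp_sub, Real.exp_log (div_pos hb ha)]
    field_simp
  have h := mul_le_mul_of_nonneg_left (Real.add_one_le_exp (x - Real.log (b / a))) hb.le
  rw [hexp]
  linarith

/-- A uniform lower bound for the separable sum `∑ i, (a * exp (x i) - b * x i)`. -/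
theorem card_mul_le_mul_sum_exp_sub_mul_sum {ι : Type*} [Fintype ι] {a b : ℝ}
    (ha : 0 < a) (hb : 0 < b) (x : ι → ℝ) :
    Fintype.card ι * (b - b * Real.log (b / a)) ≤
      a * ∑ i, Real.exp (x i) - b * ∑ i, x i := by
  rw [Finset.mul_sum, Finset.mul_sum, ← Finset.sum_sub_distrib, ← nsmul_eq_mul]
  exact Finset.card_nsmul_le_sum _ _ _ fun i _ => le_mul_exp_sub_mul ha hb (x i)

/-- For `γ > 0`, the regularized equilibration objective is bounded below. -/
theorem stmt_14 (m n : ℕ) (hm : 0 < m) (hn : 0 < n)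
    (A : Matrix (Fin m) (Fin n) ℝ) (p γ : ℝ) (hp : 1 ≤ p) (hγ : 0 < γ) :
    ∃ B : ℝ, ∀ (u : Fin m → ℝ) (v : Fin n → ℝ),
      B ≤ (∑ i, ∑ j, |A i j| ^ p * Real.exp (u i + v j))
            - n * ∑ i, u i - m * ∑ j, v j
            + γ * ((1 / m) * ∑ i, Real.exp (u i) + (1 / n) * ∑ j, Real.exp (v j)) := by
  have hm' : (0 : ℝ) < m := Nat.cast_pos.mpr hm
  have hn' : (0 : ℝ) < n := Nat.cast_pos.mpr hn
  have ham : 0 < γ * (1 / m) := by positivity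
  have han : 0 < γ * (1 / n) := by positivity
  refine ⟨Fintype.card (Fin m) * (n - n * Real.log (n / (γ * (1 / m)))) +
    Fintype.card (Fin n) * (m - m * Real.log (m / (γ * (1 / n)))), fun u v => ?_⟩
  have hu := card_mul_le_mul_sum_exp_sub_mul_sum ham hn' u
  have hv := card_mul_le_mul_sum_exp_sub_mul_sum han hm' v
  have hA : 0 ≤ ∑ i, ∑ j, |A i j| ^ p * Real.exp (u i + v j) := by positivity
  rw [mul_add, ← mul_assoc, ← mul_assoc]
  linarith
end

section
/- Let A ∈ ℝ^{m×n}, p ≥ 1, γ > 0, and let d ∈ ℝ^m, e ∈ ℝ^n have positive entries. Suppose the equilibration optimality conditions hold: Σ_{j=1}^n |A_{ij}|^p d_i e_j + (γ/m) d_i = n for each i = 1, …, m, and Σ_{i=1}^m |A_{ij}|^p d_i e_j + (γ/n) e_j = m for each j = 1, …, n. Then (1/m) Σ_{i=1}^m d_i = (1/n) Σ_{j=1}^n e_j; that is, the average entry of D = diag(d) equals the average entry of E = diag(e). -/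
open Matrix

/-- If `(d, e)` (positive) satisfy the regularized equilibration optimality conditions,
then the average entry of `D = diag(d)` equals the average entry of `E = diag(e)`. -/
theorem stmt_16 (m n : ℕ) (hm : 0 < m) (hn : 0 < n)
    (A : Matrix (Fin m) (Fin n) ℝ) (p γ : ℝ) (hp : 1 ≤ p) (hγ : 0 < γ)
    (d : Fin m → ℝ) (e : Fin n → ℝ) (hd : ∀ i, 0 < d i) (he : ∀ j, 0 < e j)
    (h1 : ∀ i, (∑ j, |A i j| ^ p * d i * e j) + (γ / m) * d i = n)
    (h2 : ∀ j, (∑ i, |A i j| ^ p * d i * e j) + (γ / n) * e j = m) :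
    (1 / m) * ∑ i, d i = (1 / n) * ∑ j, e j := by
  have hrow : (∑ i, ∑ j, |A i j| ^ p * d i * e j) + (γ / m) * ∑ i, d i = m * n := by
    rw [Finset.mul_sum, ← Finset.sum_add_distrib, Finset.sum_congr rfl fun i _ => h1 i]
    simp
  have hcol : (∑ i, ∑ j, |A i j| ^ p * d i * e j) + (γ / n) * ∑ j, e j = m * n := by
    rw [Finset.sum_comm, Finset.mul_sum, ← Finset.sum_add_distrib,
      Finset.sum_congr rfl fun j _ => h2 j]
    simp [mul_comm]
  apply mul_left_cancel₀ hγ.ne'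
  linear_combination hrow - hcol
end
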